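/- arXiv:2306.12179 — 7 statements merged into one kernel-verified Lean document; each statement's English description precedes it below -/
import Mathlib

section
/- Let Ω : ℝ → Matrix (Fin n) (Fin n) ℂ be differentiable with Ω(t) invertible for every t, and let ψ_SP : ℝ → ℂⁿ be differentiable and satisfy i • ψ_SP'(t) = 𝔥(t) ⬝ ψ_SP(t) for a family 𝔥(t) of n×n complex matrices. Define the double-ket ψ̃(t) = Ω(t)ᴴ ⬝ ψ_SP(t), H(t) = Ω(t)⁻¹ ⬝ 𝔥(t) ⬝ Ω(t), and Σ(t) = i • (Ω(t)⁻¹ ⬝ Ω'(t)). If moreover each 𝔥(t) is Hermitian, then ψ̃ is differentiable and satisfies the conjugate Schrödinger equation i • ψ̃'(t) = (H(t)ᴴ − Σ(t)ᴴ) ⬝ ψ̃(t) for every t. -/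
open Matrix

/-- Product rule for a conjugate-transposed matrix curve applied to a vector curve. -/
lemma hasDerivAt_conjTranspose_mulVec {m n : Type*} [Fintype m]
    {A : ℝ → Matrix m n ℂ} {A' : Matrix m n ℂ} {v : ℝ → m → ℂ} {v' : m → ℂ} {t : ℝ}
    (hA : ∀ i j, HasDerivAt (fun s => A s i j) (A' i j) t)
    (hv : ∀ i, HasDerivAt (fun s => v s i) (v' i) t) (j : n) :
    HasDerivAt (fun s => ((A s)ᴴ *ᵥ v s) j) ((A'ᴴ *ᵥ v t + (A t)ᴴ *ᵥ v') j) t := by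
  simp only [mulVec, dotProduct, conjTranspose_apply, Pi.add_apply, ← Finset.sum_add_distrib]
  exact HasDerivAt.fun_sum fun i _ => (hA i j).star.mul (hv i)

/-- **The conjugate NIP Schrödinger equation.** If `ψ_SP` solves the textbook Schrödinger
equation `I • ψ_SP' t = 𝔥 t ⬝ ψ_SP t` with Hermitian `𝔥 t`, `Ω` is a differentiable
invertible Dyson map with derivative `Ω'`, the double-ket is `ψ̃ t = (Ω t)ᴴ ⬝ ψ_SP t`,
`H t = (Ω t)⁻¹ * 𝔥 t * Ω t` and `Σ t = I • ((Ω t)⁻¹ * Ω' t)`, then `ψ̃` is differentiable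
and satisfies `I • ψ̃' t = ((H t)ᴴ - (Σ t)ᴴ) ⬝ ψ̃ t` for every `t`. -/
theorem nip_schrodinger_equation_for_double_ket
    {n : ℕ} (Ω Ω' : ℝ → Matrix (Fin n) (Fin n) ℂ)
    (hΩ : ∀ t : ℝ, IsUnit (Ω t))
    (hΩdiff : ∀ (t : ℝ) (i j : Fin n), HasDerivAt (fun s => Ω s i j) (Ω' t i j) t)
    (𝔥 : ℝ → Matrix (Fin n) (Fin n) ℂ)
    (h𝔥 : ∀ t : ℝ, (𝔥 t)ᴴ = 𝔥 t)
    (ψSP ψSP' : ℝ → Fin n → ℂ)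
    (hψSPdiff : ∀ (t : ℝ) (i : Fin n), HasDerivAt (fun s => ψSP s i) (ψSP' t i) t)
    (hSE : ∀ t : ℝ, Complex.I • ψSP' t = 𝔥 t *ᵥ ψSP t)
    (ψt : ℝ → Fin n → ℂ) (H Cor : ℝ → Matrix (Fin n) (Fin n) ℂ)
    (hψt : ∀ t : ℝ, ψt t = (Ω t)ᴴ *ᵥ ψSP t)
    (hH : ∀ t : ℝ, H t = (Ω t)⁻¹ * 𝔥 t * Ω t)
    (hCor : ∀ t : ℝ, Cor t = Complex.I • ((Ω t)⁻¹ * Ω' t)) :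
    ∃ ψt' : ℝ → Fin n → ℂ,
      (∀ (t : ℝ) (i : Fin n), HasDerivAt (fun s => ψt s i) (ψt' t i) t) ∧
      (∀ t : ℝ, Complex.I • ψt' t = ((H t)ᴴ - (Cor t)ᴴ) *ᵥ ψt t) := by
  refine ⟨fun t => (Ω' t)ᴴ *ᵥ ψSP t + (Ω t)ᴴ *ᵥ ψSP' t, fun t i => ?_, fun t => ?_⟩
  · simp only [hψt]
    exact hasDerivAt_conjTranspose_mulVec (hΩdiff t) (hψSPdiff t) i
  · have hinv : ((Ω t)⁻¹)ᴴ * (Ω t)ᴴ = 1 := by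
      rw [← conjTranspose_mul, mul_nonsing_inv _ ((isUnit_iff_isUnit_det _).mp (hΩ t)),
        conjTranspose_one]
    have hHam : (H t)ᴴ * (Ω t)ᴴ = (Ω t)ᴴ * 𝔥 t := by
      rw [hH, conjTranspose_mul, conjTranspose_mul, h𝔥, Matrix.mul_assoc, Matrix.mul_assoc,
        hinv, Matrix.mul_one]
    have hCoriolis : (Cor t)ᴴ * (Ω t)ᴴ = -(Complex.I • (Ω' t)ᴴ) := by
      rw [hCor, conjTranspose_smul, conjTranspose_mul, Matrix.smul_mul, Matrix.mul_assoc,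
        hinv, Matrix.mul_one, Complex.star_def, Complex.conj_I, neg_smul]
    rw [hψt, mulVec_mulVec, Matrix.sub_mul, hHam, hCoriolis, sub_neg_eq_add, add_mulVec,
      smul_mulVec, ← mulVec_mulVec, ← hSE, mulVec_smul, smul_add, add_comm]
end

section
/- Let G : ℝ → Matrix (Fin n) (Fin n) ℂ, and let ψ, ψ̃ : ℝ → ℂⁿ be differentiable functions satisfying the pair of conjugate Schrödinger equations i • ψ'(t) = G(t) ⬝ ψ(t) and i • ψ̃'(t) = G(t)ᴴ ⬝ ψ̃(t). Then the physical overlap ψ̃(t)ᴴ ⬝ ψ(t) is constant in t (its derivative vanishes identically); in particular the physical norm ⟨⟨ψ(t)|ψ(t)⟩ is conserved, i.e. the evolution generated by the two conjugate equations is unitary. -/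
open Matrix

/-- The product rule for the overlap `u(t)ᴴ ⬝ v(t)` of two vector-valued functions. -/
theorem hasDerivAt_star_dotProduct {ι : Type*} [Fintype ι] {u v : ℝ → ι → ℂ} {u' v' : ι → ℂ}
    {t : ℝ} (hu : ∀ i, HasDerivAt (fun s => u s i) (u' i) t)
    (hv : ∀ i, HasDerivAt (fun s => v s i) (v' i) t) :
    HasDerivAt (fun s => star (u s) ⬝ᵥ v s) (star u' ⬝ᵥ v t + star (u t) ⬝ᵥ v') t := by
  simp only [dotProduct, Pi.star_apply, ← Finset.sum_add_distrib]
  exact HasDerivAt.fun_sum fun i _ => (hu i).star.mul (hv i)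

/-- Conjugate generators contribute opposite terms to the derivative of the overlap. -/
theorem star_dotProduct_add_eq_zero_of_conjugate {ι : Type*} [Fintype ι] {A : Matrix ι ι ℂ}
    {u v u' v' : ι → ℂ} (hv : Complex.I • v' = A *ᵥ v) (hu : Complex.I • u' = Aᴴ *ᵥ u) :
    star u' ⬝ᵥ v + star u ⬝ᵥ v' = 0 := by
  have h₁ : star (Complex.I • u') ⬝ᵥ v = star u ⬝ᵥ (Complex.I • v') := by
    rw [hu, hv, star_mulVec, conjTranspose_conjTranspose, dotProduct_mulVec]
  simp only [star_smul, smul_dotProduct, dotProduct_smul, smul_eq_mul, Complex.star_def,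
    Complex.conj_I] at h₁
  refine (mul_eq_zero.mp ?_).resolve_left Complex.I_ne_zero
  linear_combination -h₁

/-- **Unitarity of the evolution generated by two conjugate Schrödinger equations.**
If `ψ` and `ψ̃` satisfy `I • ψ' t = G t ⬝ ψ t` and `I • ψ̃' t = (G t)ᴴ ⬝ ψ̃ t`, then the
physical overlap `ψ̃(t)ᴴ ⬝ ψ(t)` has vanishing derivative and is constant in `t`. -/
theorem conjugate_pair_overlap_conserved
    {n : ℕ} (G : ℝ → Matrix (Fin n) (Fin n) ℂ)
    (ψ ψ' ψt ψt' : ℝ → Fin n → ℂ)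
    (hψdiff : ∀ (t : ℝ) (i : Fin n), HasDerivAt (fun s => ψ s i) (ψ' t i) t)
    (hψtdiff : ∀ (t : ℝ) (i : Fin n), HasDerivAt (fun s => ψt s i) (ψt' t i) t)
    (hSE : ∀ t : ℝ, Complex.I • ψ' t = G t *ᵥ ψ t)
    (hSEt : ∀ t : ℝ, Complex.I • ψt' t = (G t)ᴴ *ᵥ ψt t) :
    (∀ t : ℝ, HasDerivAt (fun s => dotProduct (star (ψt s)) (ψ s)) 0 t) ∧
    (∀ s t : ℝ, dotProduct (star (ψt s)) (ψ s) = dotProduct (star (ψt t)) (ψ t)) := by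
  have hderiv (t : ℝ) : HasDerivAt (fun s => dotProduct (star (ψt s)) (ψ s)) 0 t := by
    rw [← star_dotProduct_add_eq_zero_of_conjugate (hSE t) (hSEt t)]
    exact hasDerivAt_star_dotProduct (hψtdiff t) (hψdiff t)
  exact ⟨hderiv, is_const_of_deriv_eq_zero (fun t => (hderiv t).differentiableAt)
    fun t => (hderiv t).deriv⟩
end

section
/- For real parameters τ and σ, the 3×3 real matrix R₃(τ,σ) = !![−2+σ, √2·τ, 0; −√2·τ, σ, √2·τ; 0, −√2·τ, 2+σ] has characteristic polynomial (X − σ)·((X − σ)² − 4(1 − τ²)). Consequently, for |τ| < 1 its eigenvalues are exactly the three real numbers σ − 2√(1−τ²), σ, σ + 2√(1−τ²). -/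
open Matrix Polynomial

/-- **The N = 3 radius operator.** `R₃(τ,σ)` has characteristic polynomial
`(X − σ)((X − σ)² − 4(1 − τ²))`; hence for `|τ| < 1` its complex eigenvalues are exactly
the three real numbers `σ − 2√(1−τ²)`, `σ`, `σ + 2√(1−τ²)`. -/
theorem radius_operator_three_spectrum (τ σ : ℝ)
    (R : Matrix (Fin 3) (Fin 3) ℝ)
    (hR : R = !![-2 + σ, Real.sqrt 2 * τ, 0;
                 -(Real.sqrt 2 * τ), σ, Real.sqrt 2 * τ;
                 0, -(Real.sqrt 2 * τ), 2 + σ]) :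
    R.charpoly = (X - C σ) * ((X - C σ) ^ 2 - C (4 * (1 - τ ^ 2))) ∧
    (|τ| < 1 →
      spectrum ℂ (R.map (Complex.ofReal)) =
        {((σ - 2 * Real.sqrt (1 - τ ^ 2) : ℝ) : ℂ), ((σ : ℝ) : ℂ),
         ((σ + 2 * Real.sqrt (1 - τ ^ 2) : ℝ) : ℂ)}) := by
  have hcp : R.charpoly = (X - C σ) * ((X - C σ) ^ 2 - C (4 * (1 - τ ^ 2))) := by
    have h2 : (C (√2) : ℝ[X]) ^ 2 = 2 := by
      rw [← C_pow, Real.sq_sqrt zero_le_two, C_ofNat]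
    rw [hR, Matrix.charpoly, det_fin_three]
    simp [C_ofNat]
    linear_combination (2 * C τ ^ 2 * (X - C σ)) * h2
  refine ⟨hcp, fun hτ => ?_⟩
  have hs : √(1 - τ ^ 2) ^ 2 = 1 - τ ^ 2 :=
    Real.sq_sqrt (sub_nonneg.2 ((sq_lt_one_iff_abs_lt_one τ).2 hτ).le)
  have hs' : ((√(1 - τ ^ 2) : ℝ) : ℂ) ^ 2 = 1 - (τ : ℂ) ^ 2 := by exact_mod_cast hs
  ext z
  change z ∈ spectrum ℂ (R.map Complex.ofRealHom) ↔ _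
  rw [mem_spectrum_iff_isRoot_charpoly, charpoly_map, hcp]
  have hfac : ((((X - C σ) * ((X - C σ) ^ 2 - C (4 * (1 - τ ^ 2)))).map Complex.ofRealHom).eval z)
      = (z - (σ - 2 * √(1 - τ ^ 2))) * ((z - σ) * (z - (σ + 2 * √(1 - τ ^ 2)))) := by
    simp
    linear_combination (4 * (z - σ)) * hs'
  rw [IsRoot.def, hfac]
  simp only [mul_eq_zero, sub_eq_zero, Set.mem_insert_iff, Set.mem_singleton_iff]
  push_cast
  rfl
end

section
/- For real parameters τ and σ, the 4×4 real matrix R₄(τ,σ) = !![−3+σ, √3·τ, 0, 0; −√3·τ, −1+σ, 2τ, 0; 0, −2τ, 1+σ, √3·τ; 0, 0, −√3·τ, 3+σ] has characteristic polynomial ((X − σ)² − (1 − τ²))·((X − σ)² − 9(1 − τ²)). Consequently, for |τ| < 1 its eigenvalues are exactly the four real numbers σ ± √(1−τ²) and σ ± 3√(1−τ²). -/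
open Matrix Polynomial

/-- **The N = 4 radius operator.** `R₄(τ,σ)` has characteristic polynomial
`((X − σ)² − (1 − τ²))((X − σ)² − 9(1 − τ²))`; hence for `|τ| < 1` its complex
eigenvalues are exactly the four real numbers `σ ± √(1−τ²)` and `σ ± 3√(1−τ²)`. -/
theorem radius_operator_four_spectrum (τ σ : ℝ)
    (R : Matrix (Fin 4) (Fin 4) ℝ)
    (hR : R = !![-3 + σ, Real.sqrt 3 * τ, 0, 0;
                 -(Real.sqrt 3 * τ), -1 + σ, 2 * τ, 0;
                 0, -(2 * τ), 1 + σ, Real.sqrt 3 * τ;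
                 0, 0, -(Real.sqrt 3 * τ), 3 + σ]) :
    R.charpoly = ((X - C σ) ^ 2 - C (1 - τ ^ 2)) * ((X - C σ) ^ 2 - C (9 * (1 - τ ^ 2))) ∧
    (|τ| < 1 →
      spectrum ℂ (R.map (Complex.ofReal)) =
        {((σ - 3 * Real.sqrt (1 - τ ^ 2) : ℝ) : ℂ), ((σ - Real.sqrt (1 - τ ^ 2) : ℝ) : ℂ),
         ((σ + Real.sqrt (1 - τ ^ 2) : ℝ) : ℂ), ((σ + 3 * Real.sqrt (1 - τ ^ 2) : ℝ) : ℂ)}) := by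
  have hchar : R.charpoly =
      ((X - C σ) ^ 2 - C (1 - τ ^ 2)) * ((X - C σ) ^ 2 - C (9 * (1 - τ ^ 2))) := by
    have h3 : (C (Real.sqrt 3) : ℝ[X]) ^ 2 = 3 := by
      rw [← C_pow, Real.sq_sqrt (by norm_num)]
      rfl
    have hC (n : ℕ) [n.AtLeastTwo] : (C (OfNat.ofNat n : ℝ) : ℝ[X]) = OfNat.ofNat n := rfl
    subst hR
    simp only [Matrix.charpoly, Matrix.charmatrix, Matrix.det_succ_row_zero, Fin.sum_univ_succ]
    simp [Fin.succAbove, Matrix.scalar_apply, hC]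
    grind
  refine ⟨hchar, fun hτ => ?_⟩
  have hs : Real.sqrt (1 - τ ^ 2) ^ 2 = 1 - τ ^ 2 :=
    Real.sq_sqrt (by nlinarith [(sq_lt_one_iff_abs_lt_one τ).2 hτ])
  generalize Real.sqrt (1 - τ ^ 2) = s at hs ⊢
  ext z
  have hmap : (R.map Complex.ofReal).charpoly = R.charpoly.map Complex.ofRealHom :=
    Matrix.charpoly_map R Complex.ofRealHom
  rw [Matrix.mem_spectrum_iff_isRoot_charpoly, hmap, hchar, ← hs, Polynomial.IsRoot.def,
    Polynomial.eval_map]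
  have hfactor : eval₂ Complex.ofRealHom z
      (((X - C σ) ^ 2 - C (s ^ 2)) * ((X - C σ) ^ 2 - C (9 * s ^ 2))) =
      (z - (σ - 3 * s : ℝ)) * ((z - (σ - s : ℝ)) * ((z - (σ + s : ℝ)) *
        (z - (σ + 3 * s : ℝ)))) := by
    simp only [eval₂_mul, eval₂_sub, eval₂_pow, eval₂_X, eval₂_C, Complex.ofRealHom_eq_coe]
    push_cast
    ring
  simp only [hfactor, mul_eq_zero, sub_eq_zero, Set.mem_insert_iff, Set.mem_singleton_iff]
end

section
/- The 3×3 real matrix M₃ = !![−2, √2, 0; −√2, 0, √2; 0, −√2, 2] (the matrix R₃(τ,σ) at the Big-Bang exceptional-point values τ = 1, σ = 0) satisfies M₃ ⬝ M₃ ≠ 0 and M₃ ⬝ M₃ ⬝ M₃ = 0; hence M₃ is nilpotent of index 3, its only eigenvalue is 0 with algebraic multiplicity 3, and M₃ is not diagonalizable. -/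
open Matrix Polynomial

/-- A nilpotent diagonalizable matrix over a reduced commutative ring vanishes. -/
theorem Matrix.eq_zero_of_isNilpotent_of_eq_conj_diagonal {n K : Type*} [Fintype n]
    [DecidableEq n] [CommRing K] [IsReduced K] {A P : Matrix n n K} {d : n → K}
    (hA : IsNilpotent A) (hP : IsUnit P) (h : A = P * diagonal d * P⁻¹) : A = 0 := by
  obtain ⟨k, hk⟩ := hA
  obtain ⟨u, rfl⟩ := hP
  rw [← Matrix.coe_units_inv] at h
  have hdiag : diagonal (d ^ k) = 0 := by
    rw [h, Units.conj_pow, Units.mul_left_eq_zero, Units.mul_right_eq_zero,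
      diagonal_pow] at hk
    exact hk
  have hd : d = 0 := IsNilpotent.eq_zero ⟨k, diagonal_eq_zero.mp hdiag⟩
  simp [h, hd]

/-- The characteristic polynomial of a nilpotent matrix over a domain is a power of `X`. -/
theorem Matrix.charpoly_eq_X_pow_of_isNilpotent {n K : Type*} [Fintype n] [DecidableEq n]
    [CommRing K] [IsDomain K] {A : Matrix n n K} (hA : IsNilpotent A) :
    A.charpoly = X ^ Fintype.card n :=
  sub_eq_zero.mp (isNilpotent_charpoly_sub_pow_of_isNilpotent hA).eq_zero

/-- **The Big-Bang exceptional point for N = 3.** The matrix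
`M₃ = !![−2, √2, 0; −√2, 0, √2; 0, −√2, 2]` (`R₃(τ,σ)` at `τ = 1`, `σ = 0`) satisfies
`M₃ * M₃ ≠ 0` and `M₃ * M₃ * M₃ = 0`: it is nilpotent of index 3, its characteristic
polynomial is `X³` (only eigenvalue `0`, algebraic multiplicity 3), and it is not
diagonalizable. -/
theorem bigBang_EP3
    (M : Matrix (Fin 3) (Fin 3) ℝ)
    (hM : M = !![-2, Real.sqrt 2, 0;
                 -(Real.sqrt 2), 0, Real.sqrt 2;
                 0, -(Real.sqrt 2), 2]) :
    M * M ≠ 0 ∧ M * M * M = 0 ∧ M.charpoly = X ^ 3 ∧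
    ¬ ∃ (P : Matrix (Fin 3) (Fin 3) ℂ) (d : Fin 3 → ℂ),
        IsUnit P ∧ M.map (Complex.ofReal) = P * Matrix.diagonal d * P⁻¹ := by
  have hsq : M * M ≠ 0 := by
    intro h
    have h00 := congrFun₂ h 0 0
    simp [hM, Matrix.mul_apply, Fin.sum_univ_three] at h00
    norm_num at h00
  have hcube : M * M * M = 0 := by
    subst hM
    ext i j
    fin_cases i <;> fin_cases j <;> simp [Matrix.mul_apply, Fin.sum_univ_three] <;> grind
  have hnil : IsNilpotent M := ⟨3, by rw [pow_three', hcube]⟩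
  refine ⟨hsq, hcube, by simpa using charpoly_eq_X_pow_of_isNilpotent hnil, ?_⟩
  rintro ⟨P, d, hP, h⟩
  have hmap := eq_zero_of_isNilpotent_of_eq_conj_diagonal
    (hnil.map (Complex.ofRealHom.mapMatrix (m := Fin 3))) hP h
  have hM0 : M = 0 :=
    (map_eq_zero_iff _ (Matrix.map_injective Complex.ofReal_injective)).mp hmap
  exact hsq (by simp [hM0])
end

section
/- For every real τ, the real symmetric matrix Θ₃(τ) = !![1, −√2·τ, τ²; −√2·τ, 1+τ², −√2·τ; τ², −√2·τ, 1] has eigenvalues exactly (1+τ)², (1−τ)·(1+τ), and (1−τ)², with corresponding eigenvectors (1, −√2, 1), (1, 0, −1), and (1, √2, 1); consequently Θ₃(τ) is positive definite for |τ| < 1, its determinant equals (1−τ²)³, and at τ = 1 it is singular with the single nonzero eigenvalue 4 = 2^{N−1}. -/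
open Matrix

/-- **Eigenvalues of the N = 3 metric.** For every real `τ`, the symmetric matrix
`Θ₃(τ)` has eigenvalues exactly `(1+τ)²`, `(1−τ)(1+τ)` and `(1−τ)²`, with eigenvectors
`(1, −√2, 1)`, `(1, 0, −1)` and `(1, √2, 1)`; it is positive definite for `|τ| < 1`,
its determinant equals `(1 − τ²)³`, and at `τ = 1` it is singular with the single
nonzero eigenvalue `4 = 2^{N−1}`. -/
theorem metric_three_eigenvalues (τ : ℝ)
    (Θ : Matrix (Fin 3) (Fin 3) ℝ)
    (hΘ : Θ = !![1, -(Real.sqrt 2 * τ), τ ^ 2;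
                 -(Real.sqrt 2 * τ), 1 + τ ^ 2, -(Real.sqrt 2 * τ);
                 τ ^ 2, -(Real.sqrt 2 * τ), 1]) :
    spectrum ℝ Θ = {(1 + τ) ^ 2, (1 - τ) * (1 + τ), (1 - τ) ^ 2} ∧
    Θ *ᵥ ![1, -(Real.sqrt 2), 1] = ((1 + τ) ^ 2) • ![1, -(Real.sqrt 2), 1] ∧
    Θ *ᵥ ![1, 0, -1] = ((1 - τ) * (1 + τ)) • ![1, 0, -1] ∧
    Θ *ᵥ ![1, Real.sqrt 2, 1] = ((1 - τ) ^ 2) • ![1, Real.sqrt 2, 1] ∧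
    (|τ| < 1 → Θ.PosDef) ∧
    Θ.det = (1 - τ ^ 2) ^ 3 ∧
    (τ = 1 → Θ.det = 0 ∧ spectrum ℝ Θ = {0, 4}) := by
  have hs : Real.sqrt 2 ^ 2 = 2 := Real.sq_sqrt zero_le_two
  have hdet : Θ.det = (1 - τ ^ 2) ^ 3 := by
    simp only [hΘ, det_fin_three, of_apply, cons_val', cons_val_zero, cons_val_one, cons_val]
    linear_combination (2 * τ ^ 4 - 2 * τ ^ 2) * hs
  have hspec : spectrum ℝ Θ = {(1 + τ) ^ 2, (1 - τ) * (1 + τ), (1 - τ) ^ 2} := by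
    ext x
    have hchar : Θ.charpoly.eval x =
        (x - (1 + τ) ^ 2) * (x - (1 - τ) * (1 + τ)) * (x - (1 - τ) ^ 2) := by
      rw [eval_charpoly, hΘ, det_fin_three]
      simp [scalar_apply]
      linear_combination (-2 * τ ^ 4 - 2 * τ ^ 2 * (x - 1)) * hs
    rw [mem_spectrum_iff_isRoot_charpoly, Polynomial.IsRoot.def, hchar]
    simp [sub_eq_zero, or_assoc]
  have hherm : Θ.IsHermitian := by
    ext i j
    fin_cases i <;> fin_cases j <;> simp [hΘ]
  refine ⟨hspec, ?_, ?_, ?_, fun hτ => ?_, hdet, ?_⟩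
  · ext i
    fin_cases i <;> simp [hΘ, mulVec, dotProduct, Fin.sum_univ_three]
    · linear_combination τ * hs
    · ring
    · linear_combination τ * hs
  · ext i
    fin_cases i <;> simp [hΘ, mulVec, dotProduct, Fin.sum_univ_three] <;> ring
  · ext i
    fin_cases i <;> simp [hΘ, mulVec, dotProduct, Fin.sum_univ_three]
    · linear_combination -τ * hs
    · ring
    · linear_combination -τ * hs
  · obtain ⟨hl, hr⟩ := abs_lt.mp hτ
    have hadd : 0 < 1 + τ := by linarith
    have hsub : 0 < 1 - τ := by linarith
    refine hherm.posDef_iff_eigenvalues_pos.mpr fun i => ?_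
    have hi := hherm.eigenvalues_mem_spectrum_real i
    rw [hspec] at hi
    rcases hi with h | h | h <;> rw [h] <;> positivity
  · rintro rfl
    refine ⟨by rw [hdet]; norm_num, ?_⟩
    rw [hspec]
    norm_num [Set.pair_comm]
end

section
/- Fix integers N ≥ 1 and 1 ≤ k ≤ N, and let θ_k(τ) = Σ_{n=1}^{N} C_{k,n} τ^{n−1} with C_{k,n} = Σ_{p=1}^{k} (−1)^{p−1} · binom(k−1, p−1) · binom(N−k, n−p). Then for every τ with 0 ≤ τ < 1 one has θ_k(τ) > 0; i.e. all N eigenvalues of the inner-product metric Θ⁽ᴺ⁾ are strictly positive throughout the post-Big-Bang regime. Moreover at τ = 1 one has θ_k(1) = 0 for every k ≥ 2 while θ_1(1) = 2^{N−1}, so the metric degenerates exactly at the Big-Bang instant. -/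
open Finset

theorem sum_Icc_one_eq_sum_range (f : ℕ → ℝ) (m : ℕ) :
    ∑ i ∈ Finset.Icc 1 m, f i = ∑ i ∈ Finset.range m, f (i + 1) := by
  have h : Finset.Icc 1 m = Finset.Ico 1 (m + 1) := by
    ext i
    simp only [Finset.mem_Icc, Finset.mem_Ico]
    omega
  rw [h, Finset.sum_Ico_eq_sum_range]
  simp [add_comm]

/-- The shifted binomial theorem, with summation range padded by zeros on both sides. -/
theorem sum_range_shifted_choose_mul_pow (b p d : ℕ) (t : ℝ) :
    ∑ n ∈ Finset.range (p + (b + 1 + d)),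
      (if p ≤ n then (Nat.choose b (n - p) : ℝ) * t ^ n else 0) = t ^ p * (1 + t) ^ b := by
  rw [Finset.sum_range_add, Finset.sum_eq_zero, zero_add, Finset.sum_range_add]
  · have tail : ∑ x ∈ Finset.range d, (if p ≤ p + (b + 1 + x) then
        (Nat.choose b (p + (b + 1 + x) - p) : ℝ) * t ^ (p + (b + 1 + x)) else 0) = 0 := by
      refine Finset.sum_eq_zero fun x _ => ?_
      rw [Nat.add_sub_cancel_left, Nat.choose_eq_zero_of_lt (by omega)]
      simp
    rw [tail, add_zero, add_comm 1 t, add_pow, Finset.mul_sum]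
    refine Finset.sum_congr rfl fun x _ => ?_
    simp only [Nat.le_add_right, if_true, Nat.add_sub_cancel_left, one_pow]
    ring
  · intro n hn
    rw [if_neg (by simpa using hn)]

/-- The generating function of the alternating binomial convolution. -/
theorem sum_range_alternating_choose_convolution (a b : ℕ) (t : ℝ) :
    ∑ n ∈ Finset.range (a + b + 1), (∑ p ∈ Finset.range (a + 1), if p ≤ n then
      (-1 : ℝ) ^ p * Nat.choose a p * Nat.choose b (n - p) else 0) * t ^ n
      = (1 - t) ^ a * (1 + t) ^ b := by
  have expand : (1 - t) ^ a = ∑ p ∈ Finset.range (a + 1), (-1 : ℝ) ^ p * Nat.choose a p * t ^ p := by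
    rw [sub_eq_neg_add, add_pow]
    refine Finset.sum_congr rfl fun p _ => ?_
    rw [neg_pow]
    ring
  simp_rw [Finset.sum_mul]
  rw [Finset.sum_comm, expand, Finset.sum_mul]
  refine Finset.sum_congr rfl fun p hp => ?_
  have hp' : p ≤ a := Nat.lt_succ_iff.mp (Finset.mem_range.mp hp)
  rw [mul_assoc, ← sum_range_shifted_choose_mul_pow b p (a - p) t, Finset.mul_sum,
    show p + (b + 1 + (a - p)) = a + b + 1 by omega]
  refine Finset.sum_congr rfl fun n _ => ?_
  split_ifs <;> ring

/-- **Positivity of the metric eigenvalues after Big Bang.** With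
`θ(τ) = Σ_{n=1}^{N} C k n · τ^{n−1}` and
`C k n = Σ_{p=1}^{k} (−1)^{p−1} binom(k−1, p−1) binom(N−k, n−p)` (binomial coefficients
vanishing on a negative lower index, encoded by the guard `p ≤ n`), one has `θ(τ) > 0`
for all `0 ≤ τ < 1`; moreover `θ(1) = 0` whenever `k ≥ 2`, while `θ(1) = 2^{N−1}` for
`k = 1`: the metric degenerates exactly at the Big-Bang instant. -/
theorem metric_eigenvalues_positive
    (N k : ℕ) (hN : 1 ≤ N) (hk1 : 1 ≤ k) (hkN : k ≤ N)
    (C : ℕ → ℝ)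
    (hC : ∀ n : ℕ, C n =
      ∑ p ∈ Finset.Icc 1 k, if p ≤ n then
        (-1 : ℝ) ^ (p - 1) * (Nat.choose (k - 1) (p - 1)) * (Nat.choose (N - k) (n - p))
      else 0)
    (θ : ℝ → ℝ)
    (hθ : ∀ τ : ℝ, θ τ = ∑ n ∈ Finset.Icc 1 N, C n * τ ^ (n - 1)) :
    (∀ τ : ℝ, 0 ≤ τ → τ < 1 → 0 < θ τ) ∧
    (2 ≤ k → θ 1 = 0) ∧
    (k = 1 → θ 1 = 2 ^ (N - 1)) := by
  obtain ⟨a, rfl⟩ : ∃ a, k = a + 1 := ⟨k - 1, by omega⟩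
  obtain ⟨b, rfl⟩ : ∃ b, N = a + b + 1 := ⟨N - (a + 1), by omega⟩
  have factor : ∀ τ : ℝ, θ τ = (1 - τ) ^ a * (1 + τ) ^ b := by
    intro τ
    rw [hθ, sum_Icc_one_eq_sum_range, ← sum_range_alternating_choose_convolution]
    refine Finset.sum_congr rfl fun n _ => ?_
    rw [hC, sum_Icc_one_eq_sum_range]
    simp only [Nat.add_sub_cancel, Nat.add_le_add_iff_right, Nat.add_sub_add_right,
      show a + b + 1 - (a + 1) = b by omega]
  refine ⟨fun τ h0 h1 => ?_, fun hk => ?_, fun hk => ?_⟩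
  · rw [factor]
    exact mul_pos (pow_pos (by linarith) a) (pow_pos (by linarith) b)
  · rw [factor, sub_self, zero_pow (by omega), zero_mul]
  · obtain rfl : a = 0 := by omega
    rw [factor]
    norm_num
end
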